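/- Let k be an algebraically closed field and let D = k[x,y]/(x³ − xy − y), which is an integral domain. Then D is Egyptian, i.e., the reciprocal complement R(D) equals the fraction field of D. (Equivalently, identifying D with the subring k[t, t³/(t+1)] of the rational function field k(t), the subring of k(t) generated by the inverses of the nonzero elements of k[t, t³/(t+1)] is all of k(t).) -/

import Mathlib

/-- The reciprocal complement of an integral domain `D` inside a field `K`
(meant to be its fraction field): the subring of `K` generated by the inverses
of the (images of the) nonzero elements of `D`. -/
def reciprocalComplement (D K : Type*) [CommRing D] [Field K] [Algebra D K] : Subring K :=
  Subring.closure {x : K | ∃ d : D, d ≠ 0 ∧ x = (algebraMap D K d)⁻¹}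

/-- The image of a unit of `D` lies in the reciprocal complement of `D`. -/
theorem algebraMap_mem_reciprocalComplement_of_isUnit {D K : Type*} [CommRing D] [Field K]
    [Algebra D K] {u : D} (hu : IsUnit u) :
    algebraMap D K u ∈ reciprocalComplement D K := by
  obtain ⟨v, huv⟩ := hu.exists_right_inv
  have h : algebraMap D K u * algebraMap D K v = 1 := by rw [← map_mul, huv, map_one]
  have := (algebraMap D K).domain_nontrivial
  exact Subring.subset_closure
    ⟨v, right_ne_zero_of_mul_eq_one huv, eq_inv_of_mul_eq_one_left h⟩

/-- If the reciprocal complement of `D` contains `D`, then it is the whole fraction field. -/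
theorem reciprocalComplement_eq_top {D K : Type*} [CommRing D] [IsDomain D] [Field K]
    [Algebra D K] [IsFractionRing D K]
    (h : ∀ d : D, algebraMap D K d ∈ reciprocalComplement D K) :
    reciprocalComplement D K = ⊤ := by
  refine eq_top_iff.mpr fun z _ => ?_
  obtain ⟨a, b, hb, rfl⟩ := IsFractionRing.div_surjective (A := D) z
  rw [div_eq_mul_inv]
  exact mul_mem (h a) (Subring.subset_closure ⟨b, nonZeroDivisors.ne_zero hb, rfl⟩)

open MvPolynomial in
/-- Over an algebraically closed field `k`, the domain
`D = k[x,y]/(x³ - xy - y)` is Egyptian: its reciprocal complement is the whole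
fraction field. -/
theorem stmt3 (k : Type*) [Field k] [IsAlgClosed k]
    (D : Type*) [CommRing D] [IsDomain D]
    (e : (MvPolynomial (Fin 2) k ⧸
        Ideal.span {(X 0 : MvPolynomial (Fin 2) k) ^ 3 - X 0 * X 1 - X 1}) ≃+* D) :
    reciprocalComplement D (FractionRing D) = ⊤ := by
  let φ : MvPolynomial (Fin 2) k →+* D := e.toRingHom.comp (Ideal.Quotient.mk _)
  have hφ : Function.Surjective φ := e.surjective.comp Ideal.Quotient.mk_surjective
  let S : Subring D := (reciprocalComplement D (FractionRing D)).comap (algebraMap D _)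
  have unit_mem {u : D} (hu : IsUnit u) : u ∈ S :=
    algebraMap_mem_reciprocalComplement_of_isUnit hu
  have hrel : φ (X 0) ^ 3 - φ (X 0) * φ (X 1) - φ (X 1) = 0 := by
    have h : φ (X 0 ^ 3 - X 0 * X 1 - X 1) = 0 := by
      change e (Ideal.Quotient.mk _ _) = 0
      rw [Ideal.Quotient.eq_zero_iff_mem.mpr (Ideal.mem_span_singleton_self _), map_zero]
    simpa only [map_sub, map_mul, map_pow] using h
  -- `x + 1` is a unit, with inverse `x² - x + 1 - y`
  have hinv : (φ (X 0) + 1) * (φ (X 0) ^ 2 - φ (X 0) + 1 - φ (X 1)) = 1 := by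
    linear_combination hrel
  have hx : φ (X 0) ∈ S := by
    simpa using sub_mem (unit_mem (.of_mul_eq_one _ hinv)) (one_mem S)
  have hy : φ (X 1) ∈ S := by
    have h := sub_mem (add_mem (sub_mem (pow_mem hx 2) hx) (one_mem S))
      (unit_mem (.of_mul_eq_one_right _ hinv))
    simpa using h
  have hS (p : MvPolynomial (Fin 2) k) : φ p ∈ S := by
    induction p using MvPolynomial.induction_on with
    | C a =>
      rcases eq_or_ne a 0 with rfl | ha
      · simp
      · exact unit_mem (ha.isUnit.map (φ.comp C))
    | add p q hp hq => simpa only [map_add] using add_mem hp hq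
    | mul_X p i hp =>
      rw [map_mul]
      fin_cases i
      exacts [mul_mem hp hx, mul_mem hp hy]
  refine reciprocalComplement_eq_top fun d => ?_
  obtain ⟨p, rfl⟩ := hφ d
  exact hS p
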